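/- (Lemma 4, Multivariate packing lemma) Let 𝒰₁,𝒰₂,𝒰₃ be finite sets and P_{U₁U₂U₃} a joint pmf with marginals P_{U₁},P_{U₂},P_{U₃}. There exists a function δ : (0,∞) → [0,∞) with δ(ε) → 0 as ε → 0 such that: for every ε > 0 and all nonnegative reals r₁,r₂,r₃ with r₁+r₂+r₃ < I(U₁;U₂) + I(U₃;U₁,U₂) − δ(ε), and for every sequence (indexed by n) of collections of random sequences {U_i^n(m)}_{m=1}^{M_i} ⊆ 𝒰_i^n (i=1,2,3) with M_i ≤ 2^{n r_i}, where each U_i^n(m) has i.i.d. entries distributed according to P_{U_i} and, for every triple of indices (m₁,m₂,m₃), the three random sequences U₁^n(m₁), U₂^n(m₂), U₃^n(m₃) are mutually independent, the probability that there exist indices m₁ ∈ [M₁], m₂ ∈ [M₂], m₃ ∈ [M₃] with (U₁^n(m₁),U₂^n(m₂),U₃^n(m₃)) ∈ T_ε^n(P_{U₁U₂U₃}) tends to 0 as n → ∞. -/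

import Mathlib

open scoped BigOperators Classical

noncomputable section

namespace BCFB

variable {Ω A B C : Type*}

/-- Probability of an event under a weight function on a finite sample space. -/
def prOf [Fintype Ω] (w : Ω → ℝ) (E : Ω → Prop) : ℝ :=
  ∑ ω, if E ω then w ω else 0

/-- Distribution (pushforward) of a random variable. -/
def distOf [Fintype Ω] (w : Ω → ℝ) (X : Ω → A) : A → ℝ :=
  fun a => prOf w fun ω => X ω = a

/-- Shannon entropy (base 2) of a random variable. -/
def entOf [Fintype Ω] [Fintype A] (w : Ω → ℝ) (X : Ω → A) : ℝ :=
  -∑ a, distOf w X a * Real.logb 2 (distOf w X a)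

/-- Mutual information (base 2). -/
def miOf [Fintype Ω] [Fintype A] [Fintype B] (w : Ω → ℝ) (X : Ω → A) (Y : Ω → B) : ℝ :=
  entOf w X + entOf w Y - entOf w fun ω => (X ω, Y ω)

/-- Conditional mutual information I(X;Y|Z) (base 2). -/
def cmiOf [Fintype Ω] [Fintype A] [Fintype B] [Fintype C]
    (w : Ω → ℝ) (X : Ω → A) (Y : Ω → B) (Z : Ω → C) : ℝ :=
  entOf w (fun ω => (X ω, Z ω)) + entOf w (fun ω => (Y ω, Z ω))
    - entOf w (fun ω => (X ω, Y ω, Z ω)) - entOf w Z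

/-- `w` is a probability mass function. -/
def IsPMF [Fintype Ω] (w : Ω → ℝ) : Prop := (∀ ω, 0 ≤ w ω) ∧ ∑ ω, w ω = 1

/-- `k` is a transition kernel (each row a pmf). -/
def IsKernel {A B : Type*} [Fintype A] [Fintype B] (k : A → B → ℝ) : Prop :=
  ∀ a, IsPMF (k a)

/-- `X — Y — Z` forms a Markov chain (i.e. `X` and `Z` are conditionally
independent given `Y`). -/
def MarkovChain [Fintype Ω] (w : Ω → ℝ) (X : Ω → A) (Y : Ω → B) (Z : Ω → C) : Prop :=
  ∀ a b c,
    distOf w (fun ω => (X ω, Y ω, Z ω)) (a, b, c) * distOf w Y b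
      = distOf w (fun ω => (X ω, Y ω)) (a, b) * distOf w (fun ω => (Z ω, Y ω)) (c, b)

/-- `X` and `Y` are independent. -/
def IndepRV [Fintype Ω] (w : Ω → ℝ) (X : Ω → A) (Y : Ω → B) : Prop :=
  ∀ a b, distOf w (fun ω => (X ω, Y ω)) (a, b) = distOf w X a * distOf w Y b

/-- Number of messages of rate `R` and blocklength `n`: `⌊2^{nR}⌋`. -/
def msgCard (n : ℕ) (R : ℝ) : ℕ := ⌊(2 : ℝ) ^ ((n : ℝ) * R)⌋₊

/-- Binary entropy function. -/
def hb (u : ℝ) : ℝ := -(u * Real.logb 2 u) - (1 - u) * Real.logb 2 (1 - u)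

/-- Empirical frequency of the letter `a` in the sequence `x`. -/
def freqOf {A : Type*} {n : ℕ} (x : Fin n → A) (a : A) : ℝ :=
  ((Finset.univ.filter fun t => x t = a).card : ℝ) / n

/-- `ε`-typicality of a sequence w.r.t. a pmf `P`. -/
def Typical {A : Type*} (ε : ℝ) {n : ℕ} (P : A → ℝ) (x : Fin n → A) : Prop :=
  ∀ a, |freqOf x a - P a| ≤ ε * P a

section NoFB

variable {X Y1 Y2 : Type*} [Fintype X] [Fintype Y1] [Fintype Y2]

/-- Error probability of a blocklength-`n` no-feedback code over the DMBC `W`. -/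
def errProbNoFB (W : X → Y1 × Y2 → ℝ) (n : ℕ) (R0 R1 R2 : ℝ)
    (enc : Fin (msgCard n R0) × Fin (msgCard n R1) × Fin (msgCard n R2) → Fin n → X)
    (dec1 : (Fin n → Y1) → Fin (msgCard n R0) × Fin (msgCard n R1))
    (dec2 : (Fin n → Y2) → Fin (msgCard n R0) × Fin (msgCard n R2)) : ℝ :=
  (1 / ((msgCard n R0 : ℝ) * (msgCard n R1 : ℝ) * (msgCard n R2 : ℝ))) *
    ∑ m : Fin (msgCard n R0) × Fin (msgCard n R1) × Fin (msgCard n R2),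
      ∑ y : Fin n → Y1 × Y2,
        (∏ t, W (enc m t) (y t)) *
          (if dec1 (fun t => (y t).1) ≠ (m.1, m.2.1) ∨ dec2 (fun t => (y t).2) ≠ (m.1, m.2.2)
            then 1 else 0)

/-- Achievability of a rate triple over the DMBC `W` without feedback. -/
def AchievableNoFB (W : X → Y1 × Y2 → ℝ) (R0 R1 R2 : ℝ) : Prop :=
  0 ≤ R0 ∧ 0 ≤ R1 ∧ 0 ≤ R2 ∧
    ∃ enc : (n : ℕ) →
        Fin (msgCard n R0) × Fin (msgCard n R1) × Fin (msgCard n R2) → Fin n → X,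
    ∃ dec1 : (n : ℕ) → (Fin n → Y1) → Fin (msgCard n R0) × Fin (msgCard n R1),
    ∃ dec2 : (n : ℕ) → (Fin n → Y2) → Fin (msgCard n R0) × Fin (msgCard n R2),
      Filter.Tendsto (fun n => errProbNoFB W n R0 R1 R2 (enc n) (dec1 n) (dec2 n))
        Filter.atTop (nhds 0)

/-- The no-feedback capacity region. -/
def CNoFB (W : X → Y1 × Y2 → ℝ) : Set (ℝ × ℝ × ℝ) :=
  closure {r | AchievableNoFB W r.1 r.2.1 r.2.2}

end NoFB

section FB

variable {X Y1 Y2 Yt : Type*} [Fintype X] [Fintype Y1] [Fintype Y2] [Fintype Yt]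

/-- Causality: the time-`t` channel input depends only on feedback symbols before time `t`. -/
def Causal {X Yt : Type*} (n : ℕ) {M : Type*} (enc : Fin n → M → (Fin n → Yt) → X) : Prop :=
  ∀ (t : Fin n) (m : M) (fb fb' : Fin n → Yt),
    (∀ s : Fin n, (s : ℕ) < (t : ℕ) → fb s = fb' s) → enc t m fb = enc t m fb'

/-- Error probability of a blocklength-`n` feedback code over the DMBC with
generalized feedback `W`. -/
def errProbFB (W : X → Y1 × Y2 × Yt → ℝ) (n : ℕ) (R0 R1 R2 : ℝ)
    (enc : Fin n → Fin (msgCard n R0) × Fin (msgCard n R1) × Fin (msgCard n R2) →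
      (Fin n → Yt) → X)
    (dec1 : (Fin n → Y1) → Fin (msgCard n R0) × Fin (msgCard n R1))
    (dec2 : (Fin n → Y2) → Fin (msgCard n R0) × Fin (msgCard n R2)) : ℝ :=
  (1 / ((msgCard n R0 : ℝ) * (msgCard n R1 : ℝ) * (msgCard n R2 : ℝ))) *
    ∑ m : Fin (msgCard n R0) × Fin (msgCard n R1) × Fin (msgCard n R2),
      ∑ y : Fin n → Y1 × Y2 × Yt,
        (∏ t, W (enc t m fun s => (y s).2.2) (y t)) *
          (if dec1 (fun t => (y t).1) ≠ (m.1, m.2.1) ∨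
              dec2 (fun t => (y t).2.1) ≠ (m.1, m.2.2)
            then 1 else 0)

/-- Achievability of a rate triple over the DMBC with generalized feedback `W`. -/
def AchievableFB (W : X → Y1 × Y2 × Yt → ℝ) (R0 R1 R2 : ℝ) : Prop :=
  0 ≤ R0 ∧ 0 ≤ R1 ∧ 0 ≤ R2 ∧
    ∃ enc : (n : ℕ) → Fin n →
        Fin (msgCard n R0) × Fin (msgCard n R1) × Fin (msgCard n R2) → (Fin n → Yt) → X,
    ∃ dec1 : (n : ℕ) → (Fin n → Y1) → Fin (msgCard n R0) × Fin (msgCard n R1),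
    ∃ dec2 : (n : ℕ) → (Fin n → Y2) → Fin (msgCard n R0) × Fin (msgCard n R2),
      (∀ n, Causal n (enc n)) ∧
      Filter.Tendsto (fun n => errProbFB W n R0 R1 R2 (enc n) (dec1 n) (dec2 n))
        Filter.atTop (nhds 0)

/-- Capacity region of the DMBC with generalized feedback `W`. -/
def CGenFB (W : X → Y1 × Y2 × Yt → ℝ) : Set (ℝ × ℝ × ℝ) :=
  closure {r | AchievableFB W r.1 r.2.1 r.2.2}

end FB

/-- Extension of a DMBC to a generalized-feedback channel with noiseless feedback
`Ỹ = (Y₁, Y₂)`. -/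
def noiselessExt {X Y1 Y2 : Type*} (W : X → Y1 × Y2 → ℝ) :
    X → Y1 × Y2 × (Y1 × Y2) → ℝ :=
  fun x y => if y.2.2 = (y.1, y.2.1) then W x (y.1, y.2.1) else 0

/-- Capacity region of a DMBC with noiseless feedback. -/
def CNoiselessFB {X Y1 Y2 : Type*} [Fintype X] [Fintype Y1] [Fintype Y2]
    (W : X → Y1 × Y2 → ℝ) : Set (ℝ × ℝ × ℝ) :=
  CGenFB (noiselessExt W)

section Marton

variable {X Y1 Y2 : Type*} [Fintype X] [Fintype Y1] [Fintype Y2]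

/-- The single-letter Marton constraints for the rate triple `(R0,R1,R2)`. -/
def MartonCond (W : X → Y1 × Y2 → ℝ) (R0 R1 R2 : ℝ) : Prop :=
  ∃ (k0 k1 k2 : ℕ) (p : Fin k0 × Fin k1 × Fin k2 → ℝ)
    (f : Fin k0 × Fin k1 × Fin k2 → X), IsPMF p ∧
    (let w : (Fin k0 × Fin k1 × Fin k2) × Y1 × Y2 → ℝ := fun z => p z.1 * W (f z.1) z.2
     let U0 := fun z : (Fin k0 × Fin k1 × Fin k2) × Y1 × Y2 => z.1.1
     let U1 := fun z : (Fin k0 × Fin k1 × Fin k2) × Y1 × Y2 => z.1.2.1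
     let U2 := fun z : (Fin k0 × Fin k1 × Fin k2) × Y1 × Y2 => z.1.2.2
     let Yr1 := fun z : (Fin k0 × Fin k1 × Fin k2) × Y1 × Y2 => z.2.1
     let Yr2 := fun z : (Fin k0 × Fin k1 × Fin k2) × Y1 × Y2 => z.2.2
     R0 < min (miOf w U0 Yr1) (miOf w U0 Yr2) ∧
     R0 + R1 < miOf w (fun z => (U0 z, U1 z)) Yr1 ∧
     R0 + R2 < miOf w (fun z => (U0 z, U2 z)) Yr2 ∧
     R0 + R1 + R2 < cmiOf w U1 Yr1 U0 + cmiOf w U2 Yr2 U0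
       + min (miOf w U0 Yr1) (miOf w U0 Yr2) - cmiOf w U1 U2 U0)

/-- Marton's achievable region for the DMBC `W` without feedback. -/
def MartonRegion (W : X → Y1 × Y2 → ℝ) : Set (ℝ × ℝ × ℝ) :=
  closure {r | 0 ≤ r.1 ∧ 0 ≤ r.2.1 ∧ 0 ≤ r.2.2 ∧ MartonCond W r.1 r.2.1 r.2.2}

end Marton

end BCFB
namespace BCFB

section PackingAux

variable {Ω A B : Type*} [Fintype Ω]

lemma prOf_mono {w : Ω → ℝ} (hw : ∀ ω, 0 ≤ w ω) {E F : Ω → Prop} (h : ∀ ω, E ω → F ω) :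
    prOf w E ≤ prOf w F := by
  unfold prOf
  refine Finset.sum_le_sum fun ω _ => ?_
  by_cases hE : E ω
  · simp [hE, h ω hE]
  · rw [if_neg hE]
    split_ifs
    exacts [hw ω, le_rfl]

lemma prOf_nonneg {w : Ω → ℝ} (hw : ∀ ω, 0 ≤ w ω) (E : Ω → Prop) : 0 ≤ prOf w E :=
  Finset.sum_nonneg fun ω _ => by
    split_ifs
    exacts [hw ω, le_rfl]

/-- Union bound. -/
lemma prOf_exists_le {ι : Type*} [Fintype ι] {w : Ω → ℝ} (hw : ∀ ω, 0 ≤ w ω)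
    (E : ι → Ω → Prop) : prOf w (fun ω => ∃ i, E i ω) ≤ ∑ i, prOf w (E i) := by
  have hnn : ∀ ω i, 0 ≤ if E i ω then w ω else 0 := fun ω i => by
    split_ifs
    exacts [hw ω, le_rfl]
  unfold prOf
  rw [Finset.sum_comm]
  refine Finset.sum_le_sum fun ω _ => ?_
  by_cases h : ∃ i, E i ω
  · obtain ⟨i, hi⟩ := h
    rw [if_pos ⟨i, hi⟩]
    calc w ω = if E i ω then w ω else 0 := (if_pos hi).symm
      _ ≤ _ := Finset.single_le_sum (fun j _ => hnn ω j) (Finset.mem_univ i)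
  · rw [if_neg h]
    exact Finset.sum_nonneg fun j _ => hnn ω j

/-- The expectation of `f ∘ X` can be computed under the law of `X`. -/
lemma sum_distOf_mul [Fintype A] (w : Ω → ℝ) (X : Ω → A) (f : A → ℝ) :
    ∑ a, distOf w X a * f a = ∑ ω, w ω * f (X ω) := by
  simp only [distOf, prOf, Finset.sum_mul]
  rw [Finset.sum_comm]
  refine Finset.sum_congr rfl fun ω _ => ?_
  simp [ite_mul]

lemma prOf_comp [Fintype A] (w : Ω → ℝ) (X : Ω → A) (E : A → Prop) :
    prOf w (fun ω => E (X ω)) = ∑ a, if E a then distOf w X a else 0 := by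
  have h := sum_distOf_mul w X fun a => if E a then 1 else 0
  simp only [mul_ite, mul_one, mul_zero] at h
  exact h.symm

lemma entOf_eq_sum [Fintype A] (w : Ω → ℝ) (X : Ω → A) :
    entOf w X = -∑ ω, w ω * Real.logb 2 (distOf w X (X ω)) := by
  rw [entOf, sum_distOf_mul w X fun a => Real.logb 2 (distOf w X a)]

lemma le_distOf {w : Ω → ℝ} (hw : ∀ ω, 0 ≤ w ω) (X : Ω → A) (ω : Ω) :
    w ω ≤ distOf w X (X ω) := by
  have h := Finset.single_le_sum (f := fun ω' => if X ω' = X ω then w ω' else 0)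
    (fun ω' _ => by
      split_ifs
      exacts [hw ω', le_rfl]) (Finset.mem_univ ω)
  simpa [distOf, prOf] using h

lemma distOf_apply_of_injective (w : Ω → ℝ) {X : Ω → A} (hX : Function.Injective X) (ω : Ω) :
    distOf w X (X ω) = w ω := by
  simp [distOf, prOf, hX.eq_iff]

lemma sum_comp_eq_freqOf [Fintype A] {n : ℕ} (x : Fin n → A) (f : A → ℝ) :
    ∑ t, f (x t) = n * ∑ a, freqOf x a * f a := by
  rcases Nat.eq_zero_or_pos n with rfl | hn
  · simp
  have hn' : (n : ℝ) ≠ 0 := by positivity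
  rw [Finset.mul_sum, ← Finset.sum_fiberwise Finset.univ x fun t => f (x t)]
  refine Finset.sum_congr rfl fun a _ => ?_
  rw [Finset.sum_congr rfl (g := fun _ => f a)
    fun t ht => by rw [(Finset.mem_filter.mp ht).2], Finset.sum_const, nsmul_eq_mul, freqOf]
  field_simp

/-- Typical average lemma. -/
lemma Typical.le_sum [Fintype A] {ε : ℝ} {n : ℕ} {P : A → ℝ} {x : Fin n → A}
    (hx : Typical ε P x) (f : A → ℝ) :
    n * (∑ a, P a * f a - ε * ∑ a, P a * |f a|) ≤ ∑ t, f (x t) := by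
  rw [sum_comp_eq_freqOf, Finset.mul_sum, ← Finset.sum_sub_distrib]
  refine mul_le_mul_of_nonneg_left (Finset.sum_le_sum fun a _ => ?_) n.cast_nonneg
  have h1 : |(freqOf x a - P a) * f a| ≤ ε * P a * |f a| := by
    rw [abs_mul]
    exact mul_le_mul_of_nonneg_right (hx a) (abs_nonneg _)
  linarith [neg_abs_le ((freqOf x a - P a) * f a)]

lemma Typical.apply_ne_zero {ε : ℝ} {n : ℕ} {P : A → ℝ} {x : Fin n → A}
    (hx : Typical ε P x) (t : Fin n) : P (x t) ≠ 0 := by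
  intro h0
  have h := hx (x t)
  rw [h0, mul_zero, sub_zero] at h
  have hf : freqOf x (x t) = 0 := abs_nonpos_iff.mp h
  have hn : (n : ℝ) ≠ 0 := by exact_mod_cast (t.pos).ne'
  rw [freqOf, div_eq_zero_iff, or_iff_left hn, Nat.cast_eq_zero, Finset.card_eq_zero] at hf
  exact Finset.notMem_empty t (hf ▸ Finset.mem_filter.mpr ⟨Finset.mem_univ t, rfl⟩)

/-- Change of measure: the probability of the `P`-typical set under i.i.d. `Q` decays with
exponent close to the relative entropy of `P` from `Q`. -/
lemma sum_typical_prod_le [Fintype A] {P Q : A → ℝ} (hP : IsPMF P)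
    (hQ : ∀ a, 0 < P a → 0 < Q a) (ε : ℝ) (n : ℕ) :
    (∑ s : Fin n → A, if Typical ε P s then ∏ t, Q (s t) else 0) ≤
      2 ^ (-(n * (∑ a, P a * Real.logb 2 (P a / Q a)
        - ε * ∑ a, P a * |Real.logb 2 (P a / Q a)|))) := by
  set L : A → ℝ := fun a => Real.logb 2 (P a / Q a)
  set c : ℝ := 2 ^ (-(n * (∑ a, P a * L a - ε * ∑ a, P a * |L a|)))
  have hprod : ∑ s : Fin n → A, ∏ t, P (s t) = 1 := by
    rw [← Fintype.prod_sum (fun (_ : Fin n) a => P a)]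
    simp [hP.2]
  calc _ ≤ ∑ s : Fin n → A, (∏ t, P (s t)) * c := by
        refine Finset.sum_le_sum fun s _ => ?_
        have hPs : 0 ≤ ∏ t, P (s t) := Finset.prod_nonneg fun t _ => hP.1 _
        split_ifs with hs
        · have hfac : ∀ t, Q (s t) = P (s t) * 2 ^ (-L (s t)) := fun t => by
            have hp := (hP.1 (s t)).lt_of_ne' (hs.apply_ne_zero t)
            have hq := hQ _ hp
            rw [Real.rpow_neg two_pos.le, Real.rpow_logb two_pos (by norm_num) (div_pos hp hq)]
            field_simp
          rw [Finset.prod_congr rfl fun t _ => hfac t, Finset.prod_mul_distrib,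
            ← Real.rpow_sum_of_pos two_pos]
          refine mul_le_mul_of_nonneg_left ?_ hPs
          refine Real.rpow_le_rpow_of_exponent_le one_le_two ?_
          rw [Finset.sum_neg_distrib]
          exact neg_le_neg (hs.le_sum L)
        · exact mul_nonneg hPs (by positivity)
    _ = c := by rw [← Finset.sum_mul, hprod, one_mul]

end PackingAux

lemma multiInfo_eq_relEntropy {A1 A2 A3 : Type*} [Fintype A1] [Fintype A2] [Fintype A3]
    {P : A1 × A2 × A3 → ℝ} (hP : ∀ a, 0 ≤ P a) :
    miOf P (fun z => z.1) (fun z => z.2.1) + miOf P (fun z => z.2.2) (fun z => (z.1, z.2.1))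
      = ∑ a, P a * Real.logb 2 (P a / (distOf P (fun z => z.1) a.1
          * distOf P (fun z => z.2.1) a.2.1 * distOf P (fun z => z.2.2) a.2.2)) := by
  have hinj : Function.Injective fun z : A1 × A2 × A3 => (z.2.2, (z.1, z.2.1)) := by
    rintro ⟨a, b, c⟩ ⟨a', b', c'⟩ h
    simp only [Prod.mk.injEq] at h ⊢
    tauto
  have hjoint : entOf P (fun z => (z.2.2, (z.1, z.2.1))) = -∑ a, P a * Real.logb 2 (P a) := by
    rw [entOf_eq_sum]
    simp_rw [fun ω => distOf_apply_of_injective P hinj ω]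
  have hterm : ∀ a, P a * Real.logb 2 (P a / (distOf P (fun z => z.1) a.1
          * distOf P (fun z => z.2.1) a.2.1 * distOf P (fun z => z.2.2) a.2.2))
      = P a * Real.logb 2 (P a) - P a * Real.logb 2 (distOf P (fun z => z.1) a.1)
        - P a * Real.logb 2 (distOf P (fun z => z.2.1) a.2.1)
        - P a * Real.logb 2 (distOf P (fun z => z.2.2) a.2.2) := fun a => by
    rcases (hP a).eq_or_lt with h | h
    · simp [← h]
    have h1 := h.trans_le (le_distOf hP (fun z => z.1) a)
    have h2 := h.trans_le (le_distOf hP (fun z => z.2.1) a)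
    have h3 := h.trans_le (le_distOf hP (fun z => z.2.2) a)
    rw [Real.logb_div h.ne' (by positivity), Real.logb_mul (by positivity) h3.ne',
      Real.logb_mul h1.ne' h2.ne']
    ring
  simp_rw [hterm, Finset.sum_sub_distrib]
  rw [miOf, miOf, hjoint, entOf_eq_sum P fun z => z.1, entOf_eq_sum P fun z => z.2.1,
    entOf_eq_sum P fun z => z.2.2]
  ring

/-- **Lemma 4 (Multivariate packing lemma).** -/
theorem multivariate_packing
    {A1 A2 A3 : Type*} [Fintype A1] [Fintype A2] [Fintype A3]
    (P : A1 × A2 × A3 → ℝ) (hP : IsPMF P) :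
    ∃ δ : ℝ → ℝ, (∀ ε : ℝ, 0 < ε → 0 ≤ δ ε) ∧
      Filter.Tendsto δ (nhdsWithin 0 (Set.Ioi 0)) (nhds 0) ∧
      ∀ ε : ℝ, 0 < ε → ∀ r1 r2 r3 : ℝ, 0 ≤ r1 → 0 ≤ r2 → 0 ≤ r3 →
        r1 + r2 + r3 <
          miOf P (fun z => z.1) (fun z => z.2.1)
            + miOf P (fun z => z.2.2) (fun z => (z.1, z.2.1)) - δ ε →
        ∀ (Ω : ℕ → Type) [∀ n, Fintype (Ω n)] (w : (n : ℕ) → Ω n → ℝ)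
          (M1 M2 M3 : ℕ → ℕ)
          (U1 : (n : ℕ) → Fin (M1 n) → Ω n → Fin n → A1)
          (U2 : (n : ℕ) → Fin (M2 n) → Ω n → Fin n → A2)
          (U3 : (n : ℕ) → Fin (M3 n) → Ω n → Fin n → A3),
          (∀ n, IsPMF (w n)) →
          (∀ n, (M1 n : ℝ) ≤ 2 ^ ((n : ℝ) * r1)) →
          (∀ n, (M2 n : ℝ) ≤ 2 ^ ((n : ℝ) * r2)) →
          (∀ n, (M3 n : ℝ) ≤ 2 ^ ((n : ℝ) * r3)) →
          -- each codeword has i.i.d. entries with the correct marginal law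
          (∀ n m (s : Fin n → A1),
            prOf (w n) (fun ω => U1 n m ω = s) = ∏ t, distOf P (fun z => z.1) (s t)) →
          (∀ n m (s : Fin n → A2),
            prOf (w n) (fun ω => U2 n m ω = s) = ∏ t, distOf P (fun z => z.2.1) (s t)) →
          (∀ n m (s : Fin n → A3),
            prOf (w n) (fun ω => U3 n m ω = s) = ∏ t, distOf P (fun z => z.2.2) (s t)) →
          -- for each triple of indices, the three codewords are mutually independent
          (∀ n m1 m2 m3 (s1 : Fin n → A1) (s2 : Fin n → A2) (s3 : Fin n → A3),
            prOf (w n) (fun ω => U1 n m1 ω = s1 ∧ U2 n m2 ω = s2 ∧ U3 n m3 ω = s3)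
              = prOf (w n) (fun ω => U1 n m1 ω = s1) * prOf (w n) (fun ω => U2 n m2 ω = s2)
                * prOf (w n) (fun ω => U3 n m3 ω = s3)) →
          Filter.Tendsto
            (fun n => prOf (w n) (fun ω => ∃ m1 m2 m3,
              Typical ε P (fun t => (U1 n m1 ω t, U2 n m2 ω t, U3 n m3 ω t))))
            Filter.atTop (nhds 0) := by
  set Q : A1 × A2 × A3 → ℝ := fun a => distOf P (fun z => z.1) a.1
    * distOf P (fun z => z.2.1) a.2.1 * distOf P (fun z => z.2.2) a.2.2
  set D : ℝ := ∑ a, P a * Real.logb 2 (P a / Q a)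
  set K : ℝ := ∑ a, P a * |Real.logb 2 (P a / Q a)|
  have hK0 : 0 ≤ K := Finset.sum_nonneg fun a _ => mul_nonneg (hP.1 a) (abs_nonneg _)
  have hQ : ∀ a, 0 < P a → 0 < Q a := fun a h =>
    mul_pos (mul_pos (h.trans_le (le_distOf hP.1 (fun z => z.1) a))
      (h.trans_le (le_distOf hP.1 (fun z => z.2.1) a)))
      (h.trans_le (le_distOf hP.1 (fun z => z.2.2) a))
  refine ⟨fun ε => ε * K, fun ε hε => mul_nonneg hε.le hK0, ?_, ?_⟩
  · have h : Filter.Tendsto (fun ε : ℝ => ε * K) (nhds 0) (nhds (0 * K)) :=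
      Filter.tendsto_id.mul_const K
    rw [zero_mul] at h
    exact h.mono_left nhdsWithin_le_nhds
  intro ε _ r1 r2 r3 _ _ _ hr Ω _ w M1 M2 M3 U1 U2 U3 hw hM1 hM2 hM3 hU1 hU2 hU3 hind
  rw [multiInfo_eq_relEntropy hP.1] at hr
  replace hr : r1 + r2 + r3 - (D - ε * K) < 0 := by linarith
  have htriple : ∀ n m1 m2 m3, prOf (w n) (fun ω =>
      Typical ε P fun t => (U1 n m1 ω t, U2 n m2 ω t, U3 n m3 ω t))
        ≤ 2 ^ (-(n * (D - ε * K))) := fun n m1 m2 m3 => by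
    refine le_trans (le_of_eq ?_) (sum_typical_prod_le hP hQ ε n)
    rw [prOf_comp (w n) (fun ω t => (U1 n m1 ω t, U2 n m2 ω t, U3 n m3 ω t)) (Typical ε P)]
    refine Finset.sum_congr rfl fun s _ => if_congr Iff.rfl ?_ rfl
    have hev : (fun ω => (fun t => (U1 n m1 ω t, U2 n m2 ω t, U3 n m3 ω t)) = s) =
        fun ω => U1 n m1 ω = (fun t => (s t).1) ∧ U2 n m2 ω = (fun t => (s t).2.1)
          ∧ U3 n m3 ω = (fun t => (s t).2.2) := by
      funext ω
      simp only [funext_iff, Prod.ext_iff, forall_and]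
    rw [distOf, hev, hind, hU1, hU2, hU3, ← Finset.prod_mul_distrib, ← Finset.prod_mul_distrib]
  have hbound : ∀ n, prOf (w n) (fun ω => ∃ m1 m2 m3,
      Typical ε P (fun t => (U1 n m1 ω t, U2 n m2 ω t, U3 n m3 ω t)))
        ≤ ((2 : ℝ) ^ (r1 + r2 + r3 - (D - ε * K))) ^ n := fun n => by
    calc _ ≤ prOf (w n) (fun ω => ∃ m : Fin (M1 n) × Fin (M2 n) × Fin (M3 n),
            Typical ε P (fun t => (U1 n m.1 ω t, U2 n m.2.1 ω t, U3 n m.2.2 ω t))) :=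
          prOf_mono (hw n).1 fun ω ⟨m1, m2, m3, h⟩ => ⟨(m1, m2, m3), h⟩
      _ ≤ ∑ _m : Fin (M1 n) × Fin (M2 n) × Fin (M3 n), (2 : ℝ) ^ (-(n * (D - ε * K))) :=
          (prOf_exists_le (hw n).1 _).trans
            (Finset.sum_le_sum fun m _ => htriple n m.1 m.2.1 m.2.2)
      _ = M1 n * (M2 n * M3 n) * (2 : ℝ) ^ (-(n * (D - ε * K))) := by simp
      _ ≤ 2 ^ (n * r1) * (2 ^ (n * r2) * 2 ^ (n * r3)) * (2 : ℝ) ^ (-(n * (D - ε * K))) := by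
          gcongr
          exacts [hM1 n, hM2 n, hM3 n]
      _ = _ := by
          rw [← Real.rpow_add two_pos, ← Real.rpow_add two_pos, ← Real.rpow_add two_pos,
            ← Real.rpow_mul_natCast two_pos.le]
          congr 1
          ring
  exact squeeze_zero (fun n => prOf_nonneg (hw n).1 _) hbound
    (tendsto_pow_atTop_nhds_zero_of_lt_one (by positivity)
      (Real.rpow_lt_one_of_one_lt_of_neg one_lt_two hr))

end BCFB
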